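/- Let M be a subspace of ℝ^{m×n} and let X* ∈ M satisfy rank(X*) = r and ‖X*‖_F = 1. Let P ∈ ℝ^{m×m} and Q ∈ ℝ^{n×n} be the orthogonal projections onto the orthogonal complements of the column space of X* and of the column space of X*ᵀ, respectively, and set T_{X*}R_r = {Z ∈ ℝ^{m×n} : P Z Q = 0}. Assume the nontangential intersection condition T_{X*}R_r ∩ M = span{X*}, and let θ ∈ (0, π/2] be defined by cos θ = max{ |⟨Z, Y⟩_F| / (‖Z‖_F ‖Y‖_F) : Z ∈ M, ⟨Z, X*⟩_F = 0, Z ≠ 0, Y ∈ T_{X*}R_r, Y ≠ 0 }. Then there exist ε₀ > 0 and C > 0 such that for every X ∈ M with ‖X‖_F = 1 and ‖X − X*‖_F < ε₀: (i) X has a unique best rank-r approximation T_r(X), i.e., a unique minimizer of ‖X − Y‖_F over matrices Y with rank(Y) ≤ r; (ii) the orthogonal projection P_M(T_r(X)) of T_r(X) onto M (with respect to the Frobenius inner product) is nonzero; and (iii) the new iterate X_new = P_M(T_r(X)) / ‖P_M(T_r(X))‖_F satisfies ‖X_new − X*‖_F ≤ (cos θ + C·‖X − X*‖_F²)·‖X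 − X*‖_F. In particular, the alternating projection iteration converges to X* at a linear rate for starting values close enough to X*. -/

import Mathlib

open Matrix

/-- Frobenius inner product of real matrices. -/
noncomputable def frobInner {m n : ℕ} (X Y : Matrix (Fin m) (Fin n) ℝ) : ℝ :=
  ∑ i, ∑ j, X i j * Y i j

/-- Frobenius norm of a real matrix. -/
noncomputable def frobNorm {m n : ℕ} (X : Matrix (Fin m) (Fin n) ℝ) : ℝ :=
  Real.sqrt (∑ i, ∑ j, (X i j) ^ 2)

section Frobenius

open scoped Matrix.Norms.Frobenius RealInnerProductSpace

variable {m n k : ℕ}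

theorem frobNorm_eq_norm (X : Matrix (Fin m) (Fin n) ℝ) : frobNorm X = ‖X‖ := by
  simp [frobNorm, Matrix.frobenius_norm_def, Real.sqrt_eq_rpow]

theorem frobNorm_pos {X : Matrix (Fin m) (Fin n) ℝ} (hX : X ≠ 0) : 0 < frobNorm X := by
  rw [frobNorm_eq_norm]
  exact norm_pos_iff.2 hX

theorem frobInner_self (X : Matrix (Fin m) (Fin n) ℝ) : frobInner X X = ‖X‖ ^ 2 := by
  rw [← frobNorm_eq_norm, frobNorm, Real.sq_sqrt (by positivity)]
  simp [frobInner, sq]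

/-- The Frobenius inner product space structure on real matrices. -/
@[reducible]
noncomputable def frobeniusInnerProductSpace :
    InnerProductSpace ℝ (Matrix (Fin m) (Fin n) ℝ) where
  inner := frobInner
  norm_sq_eq_re_inner X := by simp [frobInner_self]
  conj_inner_symm X Y := by simp [frobInner, mul_comm]
  add_left X Y Z := by simp [frobInner, add_mul, Finset.sum_add_distrib]
  smul_left X Y c := by simp [frobInner, Finset.mul_sum, mul_assoc]

attribute [local instance] frobeniusInnerProductSpace

theorem inner_eq_frobInner (X Y : Matrix (Fin m) (Fin n) ℝ) : ⟪X, Y⟫ = frobInner X Y := rfl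

theorem inner_eq_trace (X Y : Matrix (Fin m) (Fin n) ℝ) : ⟪X, Y⟫ = (Xᵀ * Y).trace := by
  rw [inner_eq_frobInner, frobInner, Finset.sum_comm]
  simp [Matrix.trace, Matrix.mul_apply]

theorem inner_mul_left_eq (X : Matrix (Fin m) (Fin n) ℝ) (S : Matrix (Fin m) (Fin k) ℝ)
    (Y : Matrix (Fin k) (Fin n) ℝ) : ⟪X, S * Y⟫ = ⟪Sᵀ * X, Y⟫ := by
  simp [inner_eq_trace, Matrix.mul_assoc]

theorem inner_mul_right_eq (X : Matrix (Fin m) (Fin n) ℝ) (Y : Matrix (Fin m) (Fin k) ℝ)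
    (S : Matrix (Fin k) (Fin n) ℝ) : ⟪X, Y * S⟫ = ⟪X * Sᵀ, Y⟫ := by
  rw [inner_eq_trace, inner_eq_trace, ← Matrix.mul_assoc, Matrix.trace_mul_comm]
  simp [Matrix.mul_assoc]

theorem frobenius_norm_mul_mul_le {l : ℕ} (X : Matrix (Fin m) (Fin n) ℝ)
    (Y : Matrix (Fin n) (Fin k) ℝ) (Z : Matrix (Fin k) (Fin l) ℝ) : ‖X * Y * Z‖ ≤ ‖X‖ * ‖Y‖ * ‖Z‖ :=
  (Matrix.frobenius_norm_mul _ _).trans <| by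
    gcongr
    exact Matrix.frobenius_norm_mul _ _

/-- Every matrix has a reflexive generalized inverse. -/
theorem exists_generalized_inverse (A : Matrix (Fin m) (Fin n) ℝ) :
    ∃ B : Matrix (Fin n) (Fin m) ℝ, A * B * A = A ∧ B * A * B = B := by
  obtain ⟨g, hg⟩ := A.toLin'.rangeRestrict.exists_rightInverse_of_surjective
    (LinearMap.range_rangeRestrict _)
  obtain ⟨g', hg'⟩ := g.exists_extend
  have key : A * LinearMap.toMatrix' g' * A = A := by
    apply Matrix.toLin'.injective
    refine LinearMap.ext fun v => ?_
    have h1 : g' (A.toLin' v) = g (A.toLin'.rangeRestrict v) :=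
      LinearMap.congr_fun hg' (A.toLin'.rangeRestrict v)
    have h2 := congrArg Subtype.val (LinearMap.congr_fun hg (A.toLin'.rangeRestrict v))
    rw [Matrix.toLin'_mul, Matrix.toLin'_mul, LinearMap.comp_apply, LinearMap.comp_apply,
      Matrix.toLin'_toMatrix', h1]
    exact h2
  generalize LinearMap.toMatrix' g' = B at key
  refine ⟨B * A * B, ?_, ?_⟩
  · calc A * (B * A * B) * A = (A * B * A) * B * A := by simp only [Matrix.mul_assoc]
      _ = A := by rw [key, key]
  · calc B * A * B * A * (B * A * B) = B * (A * B * A * B * A) * B := by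
          simp only [Matrix.mul_assoc]
      _ = B * A * B := by rw [key, key]

/-- A matrix with range contained in the range of another one is a right multiple of it. -/
theorem exists_eq_mul_of_range_le {A : Matrix (Fin m) (Fin n) ℝ} {Y : Matrix (Fin m) (Fin k) ℝ}
    (h : ∀ v, Y.mulVec v ∈ LinearMap.range A.mulVecLin) :
    ∃ T : Matrix (Fin n) (Fin k) ℝ, Y = A * T := by
  choose t ht using fun j => h (Pi.single j 1)
  refine ⟨Matrix.of fun i j => t j i, ?_⟩
  ext i j
  have := congrFun (ht j) i
  simp only [Matrix.mulVecLin_apply, Matrix.mulVec_single_one, Matrix.col_apply] at this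
  rw [← this]
  rfl

theorem isUnit_and_norm_inv_le {J : Matrix (Fin m) (Fin m) ℝ} (hJ : ‖J - 1‖ ≤ 1 / 2) :
    IsUnit J ∧ ‖J⁻¹‖ ≤ 2 * ‖(1 : Matrix (Fin m) (Fin m) ℝ)‖ := by
  have hu : IsUnit J := by
    have : ‖1 - J‖ < 1 := by rw [norm_sub_rev]; linarith
    simpa using (Units.oneSub (1 - J) this).isUnit
  refine ⟨hu, ?_⟩
  have h1 : J⁻¹ = 1 - (J - 1) * J⁻¹ := by
    rw [sub_mul, Matrix.mul_nonsing_inv _ ((Matrix.isUnit_iff_isUnit_det _).1 hu)]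
    simp
  have h2 : ‖J⁻¹‖ ≤ ‖(1 : Matrix (Fin m) (Fin m) ℝ)‖ + ‖J - 1‖ * ‖J⁻¹‖ := by
    conv_lhs => rw [h1]
    refine (norm_sub_le _ _).trans ?_
    gcongr
    exact Matrix.frobenius_norm_mul _ _
  nlinarith [norm_nonneg J⁻¹]

/-- Matrices near `A` of rank at most `A.rank` have uniformly bounded generalized inverses. -/
theorem exists_bounded_generalized_inverse (A : Matrix (Fin m) (Fin n) ℝ) :
    ∃ δ > 0, ∃ K > 0, ∀ Y : Matrix (Fin m) (Fin n) ℝ, Y.rank ≤ A.rank → ‖Y - A‖ < δ →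
      ∃ G : Matrix (Fin n) (Fin m) ℝ, ‖G‖ ≤ K ∧ Y * G * Y = Y := by
  obtain ⟨B, hABA, hBAB⟩ := exists_generalized_inverse A
  refine ⟨1 / (2 * (‖B‖ + 1)), by positivity,
    (‖B‖ + 1) * (2 * ‖(1 : Matrix (Fin m) (Fin m) ℝ)‖ + 1), by positivity, fun Y hY hYA => ?_⟩
  set J := 1 + (Y - A) * B with hJdef
  obtain ⟨hJ, hJn⟩ : IsUnit J ∧ ‖J⁻¹‖ ≤ 2 * ‖(1 : Matrix (Fin m) (Fin m) ℝ)‖ := by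
    apply isUnit_and_norm_inv_le
    rw [hJdef, add_sub_cancel_left]
    refine (Matrix.frobenius_norm_mul _ _).trans ?_
    rw [lt_div_iff₀ (by positivity)] at hYA
    nlinarith [norm_nonneg (Y - A)]
  have hdet := (Matrix.isUnit_iff_isUnit_det _).1 hJ
  have hJAB : J * (A * B) = Y * B := by
    calc J * (A * B) = A * B + (Y * (B * A * B) - A * B * A * B) := by
          simp only [hJdef, Matrix.add_mul, Matrix.sub_mul, Matrix.one_mul, Matrix.mul_assoc]
      _ = Y * B := by rw [hABA, hBAB]; abel
  have hrank : Y.rank ≤ (Y * B).rank := by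
    rw [← hJAB, Matrix.rank_mul_eq_right_of_isUnit_det _ _ hdet]
    calc Y.rank ≤ A.rank := hY
      _ = (A * B * A).rank := by rw [hABA]
      _ ≤ (A * B).rank := Matrix.rank_mul_le_left _ _
  have hrange : LinearMap.range (Y * B).mulVecLin = LinearMap.range Y.mulVecLin := by
    apply Submodule.eq_of_le_of_finrank_le _ hrank
    rw [Matrix.mulVecLin_mul]
    exact LinearMap.range_comp_le_range _ _
  obtain ⟨T, hT⟩ := exists_eq_mul_of_range_le (A := Y * B) (Y := Y)
    fun v => hrange ▸ LinearMap.mem_range_self Y.mulVecLin v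
  refine ⟨B * J⁻¹, ?_, ?_⟩
  · refine (Matrix.frobenius_norm_mul _ _).trans ?_
    gcongr <;> linarith
  · have h1 : Y * (B * J⁻¹) * (Y * B) = Y * B := by
      have h2 : J⁻¹ * (Y * B) = A * B := by
        rw [← hJAB, ← Matrix.mul_assoc, Matrix.nonsing_inv_mul _ hdet, Matrix.one_mul]
      calc Y * (B * J⁻¹) * (Y * B) = Y * (B * (J⁻¹ * (Y * B))) := by
            simp only [Matrix.mul_assoc]
        _ = Y * B := by rw [h2, ← Matrix.mul_assoc B, hBAB]
    have h3 : Y * (B * J⁻¹) * (Y * B) * T = Y * B * T := by rw [h1]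
    rwa [Matrix.mul_assoc _ (Y * B) T, ← hT] at h3

theorem isClosed_setOf_rank_le (r : ℕ) :
    IsClosed {Y : Matrix (Fin m) (Fin n) ℝ | Y.rank ≤ r} := by
  let Φ : Matrix (Fin m) (Fin n) ℝ →ₗ[ℝ] ((Fin n → ℝ) →L[ℝ] (Fin m → ℝ)) :=
    LinearMap.toContinuousLinearMap.toLinearMap ∘ₗ Matrix.toLin'.toLinearMap
  have hΦ : Continuous Φ := Φ.continuous_of_finiteDimensional
  have h := (isOpen_setOfPred_nat_le_rank (𝕜 := ℝ) (E := Fin n → ℝ) (F := Fin m → ℝ)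
    (r + 1)).preimage hΦ
  rw [← isOpen_compl_iff]
  convert h using 1
  ext Y
  have : (Φ Y : (Fin n → ℝ) →ₗ[ℝ] (Fin m → ℝ)).rank = (Y.rank : Cardinal) := by
    rw [Matrix.rank, Module.finrank_eq_rank]
    rfl
  simp only [Set.mem_compl_iff, Set.mem_ofPred_eq, not_le, Set.mem_preimage]
  rw [this, Nat.cast_le, Nat.succ_le_iff]

/-- `Y` is a best approximation of `X` among the matrices of rank at most `r`. -/
def IsBestRankApprox (r : ℕ) (X Y : Matrix (Fin m) (Fin n) ℝ) : Prop :=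
  Y.rank ≤ r ∧ ∀ Z : Matrix (Fin m) (Fin n) ℝ, Z.rank ≤ r → ‖X - Y‖ ≤ ‖X - Z‖

theorem exists_isBestRankApprox (r : ℕ) (X : Matrix (Fin m) (Fin n) ℝ) :
    ∃ Y, IsBestRankApprox r X Y := by
  obtain ⟨Y, hY, h⟩ := (isClosed_setOf_rank_le (m := m) (n := n) r).exists_infDist_eq_dist
    ⟨0, by simp⟩ X
  refine ⟨Y, hY, fun Z hZ => ?_⟩
  rw [← dist_eq_norm, ← dist_eq_norm, ← h]
  exact Metric.infDist_le_dist_of_mem hZ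

theorem inner_eq_zero_of_norm_le_norm_sub_smul {N D : Matrix (Fin m) (Fin n) ℝ}
    (h : ∀ t : ℝ, ‖N‖ ≤ ‖N - t • D‖) : ⟪N, D⟫ = 0 := by
  by_contra hne
  have hD : 0 < ‖D‖ ^ 2 := by
    have : D ≠ 0 := by rintro rfl; simp at hne
    positivity
  have h1 := pow_le_pow_left₀ (norm_nonneg _) (h (⟪N, D⟫ / ‖D‖ ^ 2)) 2
  rw [norm_sub_sq_real, inner_smul_right, norm_smul, mul_pow, Real.norm_eq_abs, sq_abs] at h1
  have h2 : (⟪N, D⟫ / ‖D‖ ^ 2) ^ 2 * ‖D‖ ^ 2 = ⟪N, D⟫ ^ 2 / ‖D‖ ^ 2 := by field_simp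
  have h3 : 2 * (⟪N, D⟫ / ‖D‖ ^ 2 * ⟪N, D⟫) = 2 * (⟪N, D⟫ ^ 2 / ‖D‖ ^ 2) := by ring
  have h4 : 0 < ⟪N, D⟫ ^ 2 / ‖D‖ ^ 2 := by positivity
  linarith

/-- The residual of a best rank-`r` approximation is normal to its column and row spaces. -/
theorem IsBestRankApprox.transpose_mul_eq_zero {r : ℕ} {X Y : Matrix (Fin m) (Fin n) ℝ}
    (h : IsBestRankApprox r X Y) : Yᵀ * (X - Y) = 0 := by
  have key : ⟪X - Y, Y * (Yᵀ * (X - Y))⟫ = 0 :=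
    inner_eq_zero_of_norm_le_norm_sub_smul fun t => by
      have : X - Y - t • (Y * (Yᵀ * (X - Y))) = X - Y * (1 + t • (Yᵀ * (X - Y))) := by
        rw [Matrix.mul_add, Matrix.mul_smul, Matrix.mul_one]; abel
      rw [this]
      exact h.2 _ ((Matrix.rank_mul_le_left _ _).trans h.1)
  rwa [inner_mul_left_eq, inner_self_eq_zero] at key

theorem IsBestRankApprox.mul_transpose_eq_zero {r : ℕ} {X Y : Matrix (Fin m) (Fin n) ℝ}
    (h : IsBestRankApprox r X Y) : (X - Y) * Yᵀ = 0 := by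
  have key : ⟪X - Y, (X - Y) * Yᵀ * Y⟫ = 0 :=
    inner_eq_zero_of_norm_le_norm_sub_smul fun t => by
      have : X - Y - t • ((X - Y) * Yᵀ * Y) = X - (1 + t • ((X - Y) * Yᵀ)) * Y := by
        rw [Matrix.add_mul, Matrix.smul_mul, Matrix.one_mul]; abel
      rw [this]
      exact h.2 _ ((Matrix.rank_mul_le_right _ _).trans h.1)
  rwa [inner_mul_right_eq, inner_self_eq_zero] at key

theorem IsBestRankApprox.norm_sub_le {r : ℕ} {X Y A : Matrix (Fin m) (Fin n) ℝ}
    (h : IsBestRankApprox r X Y) (hA : A.rank ≤ r) : ‖Y - A‖ ≤ 2 * ‖X - A‖ := by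
  have h1 := h.2 A hA
  have h2 : ‖Y - A‖ ≤ ‖X - A‖ + ‖X - Y‖ := by
    simpa using _root_.norm_sub_le (X - A) (X - Y)
  linarith

/-- A point `Y` with normal residual beats every other matrix with a bounded generalized
inverse, provided that the residual is small. -/
theorem eq_of_norm_sub_le_of_normal {X Y Y' : Matrix (Fin m) (Fin n) ℝ}
    {G : Matrix (Fin n) (Fin m) ℝ} (hl : Yᵀ * (X - Y) = 0) (hr : (X - Y) * Yᵀ = 0)
    (hG : Y' * G * Y' = Y') (hsmall : 2 * (‖X - Y‖ * ‖G‖) < 1)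
    (hle : ‖X - Y'‖ ≤ ‖X - Y‖) : Y' = Y := by
  set N := X - Y with hN
  set D := Y' - Y with hD
  have hY' : Y' = Y + D := by rw [hD]; abel
  have h1 : ⟪N, D⟫ = ⟪N, D * G * D⟫ := by
    have e1 : ⟪N, Y⟫ = 0 := by
      rw [real_inner_comm, inner_eq_trace, hl, Matrix.trace_zero]
    have e2 : ∀ S : Matrix (Fin n) (Fin n) ℝ, ⟪N, Y * S⟫ = 0 := fun S => by
      rw [inner_mul_left_eq, hl, inner_zero_left]
    have e3 : ∀ S : Matrix (Fin m) (Fin m) ℝ, ⟪N, S * Y⟫ = 0 := fun S => by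
      rw [inner_mul_right_eq, hr, inner_zero_left]
    have e4 : D = Y * (G * Y') + D * G * Y + D * G * D - Y := by
      have : Y * (G * Y') + D * G * Y + D * G * D = Y' * G * Y' := by
        rw [hY']; simp only [Matrix.add_mul, Matrix.mul_add, Matrix.mul_assoc]; abel
      rw [this, hG]
    conv_lhs => rw [e4]
    rw [inner_sub_right, inner_add_right, inner_add_right, e1, e2, e3]
    ring
  have h2 : ⟪N, D⟫ ≤ ‖N‖ * (‖D‖ * ‖G‖ * ‖D‖) := by
    rw [h1]
    refine (real_inner_le_norm _ _).trans ?_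
    gcongr
    exact frobenius_norm_mul_mul_le _ _ _
  have h3 : X - Y' = N - D := by rw [hN, hD]; abel
  have h4 := pow_le_pow_left₀ (norm_nonneg _) hle 2
  rw [h3, norm_sub_sq_real] at h4
  have h5 : ‖D‖ ^ 2 * (1 - 2 * (‖N‖ * ‖G‖)) ≤ 0 := by nlinarith
  have h6 : ‖D‖ ^ 2 = 0 := by
    by_contra hne
    have : 0 < ‖D‖ ^ 2 := lt_of_le_of_ne (by positivity) (Ne.symm hne)
    nlinarith
  exact sub_eq_zero.1 (norm_eq_zero.1 (pow_eq_zero_iff two_ne_zero |>.1 h6))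

/-- The complementary projection to the range of `A` kills `A`, and its complement factors
through `A`. -/
theorem mul_eq_zero_and_exists_one_sub_eq_mul {A : Matrix (Fin m) (Fin n) ℝ}
    {P : Matrix (Fin m) (Fin m) ℝ} (hP : P * P = P)
    (hker : ∀ v : Fin m → ℝ, P.mulVec v = 0 ↔ v ∈ LinearMap.range A.mulVecLin) :
    P * A = 0 ∧ ∃ C : Matrix (Fin n) (Fin m) ℝ, 1 - P = A * C := by
  constructor
  · apply Matrix.toLin'.injective
    refine LinearMap.ext fun v => ?_
    have : P *ᵥ (A *ᵥ v) = 0 := (hker _).2 ⟨v, rfl⟩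
    simpa using this
  · refine exists_eq_mul_of_range_le fun v => (hker _).1 ?_
    rw [Matrix.mulVec_mulVec, Matrix.mul_sub, hP, Matrix.mul_one, sub_self, Matrix.zero_mulVec]

/-- Near `A`, best approximations of rank at most `A.rank` are strictly better than every other
point with normal residual. -/
theorem exists_forall_isBestRankApprox_eq (A : Matrix (Fin m) (Fin n) ℝ) :
    ∃ ε > 0, ∀ X Y Y' : Matrix (Fin m) (Fin n) ℝ, ‖X - A‖ < ε → IsBestRankApprox A.rank X Y' →
      Y.rank ≤ A.rank → ‖X - Y‖ ≤ 2 * ‖X - A‖ → Yᵀ * (X - Y) = 0 → (X - Y) * Yᵀ = 0 →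
      Y' = Y := by
  obtain ⟨δ, hδ, K, hK, hG⟩ := exists_bounded_generalized_inverse A
  refine ⟨min (δ / 2) (1 / (4 * K)), by positivity, fun X Y Y' hX hY' hY hXY hl hr => ?_⟩
  obtain ⟨h1, h2⟩ := lt_min_iff.1 hX
  have h3 := hY'.norm_sub_le le_rfl
  obtain ⟨G, hGK, hG⟩ := hG Y' hY'.1 (by linarith)
  refine eq_of_norm_sub_le_of_normal hl hr hG ?_ (hY'.2 Y hY)
  rw [lt_div_iff₀ (by positivity)] at h2
  have h4 : ‖X - Y‖ * ‖G‖ ≤ 2 * ‖X - A‖ * K := by gcongr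
  linarith

/-- The best rank approximation agrees to first order with the tangent space projection. -/
theorem exists_tangent_error_bound {A : Matrix (Fin m) (Fin n) ℝ}
    {P : Matrix (Fin m) (Fin m) ℝ} {Q : Matrix (Fin n) (Fin n) ℝ}
    {C : Matrix (Fin n) (Fin m) ℝ} {D : Matrix (Fin m) (Fin n) ℝ}
    (hPsymm : Pᵀ = P) (hPA : P * A = 0) (hAQ : A * Q = 0)
    (hC : 1 - P = A * C) (hD : 1 - Q = Aᵀ * D) :
    ∃ ε > 0, ∃ K ≥ 0, ∀ X Y : Matrix (Fin m) (Fin n) ℝ, ‖X - A‖ < ε →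
      IsBestRankApprox A.rank X Y →
      ‖(X - A) - P * (X - A) * Q - (Y - A)‖ ≤ K * ‖X - A‖ ^ 2 := by
  obtain ⟨δ, hδ, K, hK, hG⟩ := exists_bounded_generalized_inverse A
  refine ⟨δ / 2, by positivity,
    2 * ‖Cᵀ‖ + 2 * ‖P‖ * ‖D‖ + 4 * ‖P‖ * K * ‖Q‖, by positivity, fun X Y hX hY => ?_⟩
  have hH2 := hY.norm_sub_le le_rfl
  have hN1 := hY.2 A le_rfl
  obtain ⟨G, hGK, hG⟩ := hG Y hY.1 (by linarith)
  have hl := hY.transpose_mul_eq_zero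
  have hr := hY.mul_transpose_eq_zero
  set N := X - Y with hN
  set H := Y - A with hH
  set ε := ‖X - A‖ with hε
  have hE : X - A = H + N := by rw [hN, hH]; abel
  have hYH : Y = A + H := by rw [hH]; abel
  have hPN : N - P * N = -(Cᵀ * Hᵀ * N) := by
    have h1 : 1 - P = Cᵀ * Aᵀ := by
      rw [← Matrix.transpose_mul, ← hC, Matrix.transpose_sub, Matrix.transpose_one, hPsymm]
    have h2 : Aᵀ * N = -(Hᵀ * N) := by
      rw [hYH, Matrix.transpose_add, Matrix.add_mul] at hl
      exact eq_neg_of_add_eq_zero_left hl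
    calc N - P * N = (1 - P) * N := by rw [Matrix.sub_mul, Matrix.one_mul]
      _ = _ := by rw [h1, Matrix.mul_assoc, h2, Matrix.mul_neg, Matrix.mul_assoc]
  have hNQ : N - N * Q = -(N * Hᵀ * D) := by
    have h2 : N * Aᵀ = -(N * Hᵀ) := by
      rw [hYH, Matrix.transpose_add, Matrix.mul_add] at hr
      exact eq_neg_of_add_eq_zero_left hr
    calc N - N * Q = N * (1 - Q) := by rw [Matrix.mul_sub, Matrix.mul_one]
      _ = _ := by rw [hD, ← Matrix.mul_assoc, h2, Matrix.neg_mul]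
  have hPHQ : P * H * Q = P * (H * G * H) * Q := by
    have h1 : P * H = P * Y := by rw [hYH, Matrix.mul_add, hPA, zero_add]
    have h2 : H * Q = Y * Q := by rw [hYH, Matrix.add_mul, hAQ, zero_add]
    calc P * H * Q = P * Y * Q := by rw [h1]
      _ = P * (Y * G * Y) * Q := by rw [hG]
      _ = (P * Y) * G * (Y * Q) := by simp only [Matrix.mul_assoc]
      _ = _ := by rw [← h1, ← h2]; simp only [Matrix.mul_assoc]
  have hsplit : (X - A) - P * (X - A) * Q - H
      = (N - P * N) + P * (N - N * Q) - P * (H * G * H) * Q := by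
    rw [← hPHQ, hE]
    simp only [Matrix.mul_sub, Matrix.mul_add, Matrix.add_mul, Matrix.mul_assoc]
    abel
  have b1 : ‖N - P * N‖ ≤ ‖Cᵀ‖ * (2 * ε) * ε := by
    rw [hPN, norm_neg]
    refine (frobenius_norm_mul_mul_le _ _ _).trans ?_
    rw [Matrix.frobenius_norm_transpose H]
    gcongr
  have b2 : ‖P * (N - N * Q)‖ ≤ ‖P‖ * (ε * (2 * ε) * ‖D‖) := by
    refine (Matrix.frobenius_norm_mul _ _).trans ?_
    rw [hNQ, norm_neg]
    gcongr
    refine (frobenius_norm_mul_mul_le _ _ _).trans ?_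
    rw [Matrix.frobenius_norm_transpose H]
    gcongr
  have b3 : ‖P * (H * G * H) * Q‖ ≤ ‖P‖ * (2 * ε * K * (2 * ε)) * ‖Q‖ := by
    refine (frobenius_norm_mul_mul_le _ _ _).trans ?_
    gcongr
    refine (frobenius_norm_mul_mul_le _ _ _).trans ?_
    gcongr
  rw [hsplit]
  refine (norm_sub_le _ _).trans ?_
  have := norm_add_le (N - P * N) (P * (N - N * Q))
  linarith

/-- Contraction estimate for the two successive projections onto the tangent space and `M`. -/
theorem norm_tangent_le {M : Submodule ℝ (Matrix (Fin m) (Fin n) ℝ)}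
    {A Z : Matrix (Fin m) (Fin n) ℝ} {P : Matrix (Fin m) (Fin m) ℝ}
    {Q : Matrix (Fin n) (Fin n) ℝ} {c : ℝ} (hc : 0 ≤ c)
    (hPsymm : Pᵀ = P) (hPidem : P * P = P) (hQsymm : Qᵀ = Q) (hQidem : Q * Q = Q)
    (hPA : P * A = 0) (hA : A ∈ M)
    (hangle : ∀ Z ∈ M, ⟪Z, A⟫ = 0 → ∀ Y, P * Y * Q = 0 → ⟪Z, Y⟫ ≤ c * ‖Z‖ * ‖Y‖)
    (hZ : Z ∈ M) (hZA : ⟪Z, A⟫ = 0) :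
    ‖Z - P * Z * Q‖ ≤ c * ‖Z‖ ∧ ⟪M.starProjection (Z - P * Z * Q), A⟫ = 0 ∧
      ‖M.starProjection (Z - P * Z * Q)‖ ≤ c ^ 2 * ‖Z‖ := by
  set τ := Z - P * Z * Q with hτdef
  set V := M.starProjection τ with hV
  have hτ : P * τ * Q = 0 := by
    have : P * (P * Z * Q) * Q = P * Z * Q := by
      calc P * (P * Z * Q) * Q = (P * P) * Z * (Q * Q) := by simp only [Matrix.mul_assoc]
        _ = _ := by rw [hPidem, hQidem]
    rw [hτdef, Matrix.mul_sub, Matrix.sub_mul, this, sub_self]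
  have hadj : ∀ Y, ⟪P * Z * Q, Y⟫ = ⟪Z, P * Y * Q⟫ := fun Y => by
    rw [inner_mul_right_eq, inner_mul_left_eq, hPsymm, hQsymm, Matrix.mul_assoc]
  have h1 : ‖τ‖ ^ 2 = ⟪Z, τ⟫ := by
    rw [← real_inner_self_eq_norm_sq]
    conv_lhs => enter [2]; rw [hτdef]
    rw [inner_sub_left, hadj, hτ, inner_zero_right, sub_zero]
  have h2 : ‖τ‖ ≤ c * ‖Z‖ := by
    have := hangle Z hZ hZA τ hτ
    rw [← h1] at this
    by_contra! hlt
    have : 0 < ‖τ‖ := lt_of_le_of_lt (by positivity) hlt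
    nlinarith
  have hVA : ⟪V, A⟫ = 0 := by
    rw [hV, Submodule.inner_starProjection_left_eq_right,
      Submodule.starProjection_eq_self_iff.2 hA, hτdef, inner_sub_left, hZA, hadj, hPA]
    simp
  have hVM : V ∈ M := M.starProjection_apply_mem τ
  have h3 : ‖V‖ ^ 2 = ⟪V, τ⟫ := by
    rw [← real_inner_self_eq_norm_sq]
    conv_lhs => enter [3]; rw [hV]
    rw [← Submodule.inner_starProjection_left_eq_right, Submodule.starProjection_eq_self_iff.2 hVM]
  refine ⟨h2, hVA, ?_⟩
  have h4 := hangle V hVM hVA τ hτ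
  rw [← h3] at h4
  have h5 : ‖V‖ ≤ c * ‖τ‖ := by
    by_contra! hlt
    have : 0 < ‖V‖ := lt_of_le_of_lt (by positivity) hlt
    nlinarith
  calc ‖V‖ ≤ c * ‖τ‖ := h5
    _ ≤ c * (c * ‖Z‖) := by gcongr
    _ = c ^ 2 * ‖Z‖ := by ring

theorem norm_normalize_sub_le {E : Type*} [NormedAddCommGroup E] [InnerProductSpace ℝ E]
    {A V W : E} (hA : ‖A‖ = 1) (hVA : ⟪V, A⟫ = 0) (hW : W ≠ 0) :
    ‖‖W‖⁻¹ • W - A‖ ≤ ‖V‖ + ‖V‖ ^ 2 + 2 * ‖W - (A + V)‖ := by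
  have h0 : 0 < ‖W‖ := norm_pos_iff.2 hW
  have h1 : ‖‖W‖⁻¹ • W - W‖ = |1 - ‖W‖| := by
    have : ‖W‖⁻¹ • W - W = (‖W‖⁻¹ - 1) • W := by rw [sub_smul, one_smul]
    rw [this, norm_smul, Real.norm_eq_abs, ← abs_of_pos h0, ← abs_mul, abs_of_pos h0, sub_mul,
      inv_mul_cancel₀ h0.ne', one_mul]
  have h2 : ‖A + V‖ ^ 2 = 1 + ‖V‖ ^ 2 := by
    rw [norm_add_sq_real, real_inner_comm, hVA, hA]; ring
  have h3 : |‖A + V‖ - ‖W‖| ≤ ‖W - (A + V)‖ := by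
    rw [norm_sub_rev]; exact abs_norm_sub_norm_le _ _
  have h4 : |1 - ‖A + V‖| ≤ ‖V‖ ^ 2 := by
    rw [abs_le]
    constructor <;> nlinarith [norm_nonneg (A + V), sq_nonneg ‖V‖]
  have h5 : |1 - ‖W‖| ≤ ‖V‖ ^ 2 + ‖W - (A + V)‖ := by
    rw [← sub_add_sub_cancel 1 ‖A + V‖ ‖W‖]
    exact (abs_add_le _ _).trans (add_le_add h4 h3)
  have h6 : ‖W - A‖ ≤ ‖W - (A + V)‖ + ‖V‖ := by
    rw [show W - A = (W - (A + V)) + V by abel]; exact norm_add_le _ _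
  have h7 : ‖‖W‖⁻¹ • W - A‖ ≤ ‖‖W‖⁻¹ • W - W‖ + ‖W - A‖ := by
    rw [← sub_add_sub_cancel _ W A]; exact norm_add_le _ _
  linarith

theorem inner_sub_self_eq_of_norm_eq_one {E : Type*} [NormedAddCommGroup E]
    [InnerProductSpace ℝ E] {A X : E} (hA : ‖A‖ = 1) (hX : ‖X‖ = 1) :
    ⟪X - A, A⟫ = -(‖X - A‖ ^ 2 / 2) := by
  rw [norm_sub_sq_real, inner_sub_left, real_inner_self_eq_norm_sq, hA, hX]
  ring

/-- A second-order perturbation of `A + T` still contracts after projection to `M` and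
normalization. -/
theorem starProjection_ne_zero_and_norm_normalize_sub_le {E : Type*} [NormedAddCommGroup E]
    [InnerProductSpace ℝ E] {M : Submodule ℝ E} [M.HasOrthogonalProjection] {A T R Y : E}
    {c e K : ℝ} (hc : 0 ≤ c) (hc1 : c ≤ 1) (hA : A ∈ M) (hA1 : ‖A‖ = 1)
    (hTA : ⟪M.starProjection T, A⟫ = 0) (hT : ‖M.starProjection T‖ ≤ c ^ 2 * e)
    (hR : ‖R‖ ≤ K * e ^ 2) (he0 : 0 ≤ e) (he1 : e < 1) (heK : e * (1 + K) < 1)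
    (hY : Y = A + T - (e ^ 2 / 2) • A - R) :
    M.starProjection Y ≠ 0 ∧
      ‖‖M.starProjection Y‖⁻¹ • M.starProjection Y - A‖ ≤ (c ^ 2 + (2 + 2 * K) * e) * e := by
  set V := M.starProjection T
  have hWsplit : M.starProjection Y - (A + V) = -((e ^ 2 / 2) • A + M.starProjection R) := by
    rw [hY, map_sub, map_sub, map_add, map_smul, Submodule.starProjection_eq_self_iff.2 hA]
    abel
  have hρ : ‖M.starProjection Y - (A + V)‖ ≤ (1 / 2 + K) * e ^ 2 := by
    rw [hWsplit, norm_neg]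
    refine (norm_add_le _ _).trans ?_
    have h1 := (M.norm_starProjection_apply_le R).trans hR
    rw [norm_smul, hA1, Real.norm_eq_abs, abs_of_nonneg (by positivity)]
    linarith
  have hρ1 : (1 / 2 + K) * e ^ 2 < 1 := by nlinarith
  have hW0 : M.starProjection Y ≠ 0 := by
    intro h0
    rw [h0, zero_sub, norm_neg] at hρ
    have h2 : ‖A + V‖ ^ 2 = 1 + ‖V‖ ^ 2 := by
      rw [norm_add_sq_real, real_inner_comm, hTA, hA1]; ring
    nlinarith [norm_nonneg (A + V), sq_nonneg ‖V‖]
  refine ⟨hW0, (norm_normalize_sub_le hA1 hTA hW0).trans ?_⟩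
  have hVe : ‖V‖ ≤ e := hT.trans (mul_le_of_le_one_left he0 (pow_le_one₀ hc hc1))
  have h1 : ‖V‖ ^ 2 ≤ e ^ 2 := pow_le_pow_left₀ (norm_nonneg _) hVe 2
  linarith

/-- Local linear convergence of alternating projections, with rate `c ^ 2 + O(‖X - A‖)` when
`0 < c` and in a single step when `c = 0`; in both cases the rate is eventually at most `c`. -/
theorem exists_local_contraction {M : Submodule ℝ (Matrix (Fin m) (Fin n) ℝ)}
    {A : Matrix (Fin m) (Fin n) ℝ} {P : Matrix (Fin m) (Fin m) ℝ}
    {Q : Matrix (Fin n) (Fin n) ℝ} {C : Matrix (Fin n) (Fin m) ℝ}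
    {D : Matrix (Fin m) (Fin n) ℝ} {c : ℝ} (hc : 0 ≤ c) (hc1 : c < 1)
    (hPsymm : Pᵀ = P) (hPidem : P * P = P) (hQsymm : Qᵀ = Q) (hQidem : Q * Q = Q)
    (hPA : P * A = 0) (hAQ : A * Q = 0) (hC : 1 - P = A * C) (hD : 1 - Q = Aᵀ * D)
    (hA : A ∈ M) (hA1 : ‖A‖ = 1)
    (hangle : ∀ Z ∈ M, ⟪Z, A⟫ = 0 → ∀ Y, P * Y * Q = 0 → ⟪Z, Y⟫ ≤ c * ‖Z‖ * ‖Y‖) :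
    ∃ ε > 0, ∀ X ∈ M, ‖X‖ = 1 → ‖X - A‖ < ε →
      (∃! Y, IsBestRankApprox A.rank X Y) ∧
      ∀ Y, IsBestRankApprox A.rank X Y →
        ∃ W ∈ M, (∀ Z ∈ M, ⟪Y - W, Z⟫ = 0) ∧ W ≠ 0 ∧
          ‖‖W‖⁻¹ • W - A‖ ≤ c * ‖X - A‖ := by
  obtain ⟨δ₁, hδ₁, huniq⟩ := exists_forall_isBestRankApprox_eq A
  obtain ⟨δ₂, hδ₂, K, hK, herr⟩ :=
    exists_tangent_error_bound hPsymm hPA hAQ hC hD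
  obtain ⟨δ₃, hδ₃, hδ₃c⟩ : ∃ δ > 0, 0 < c → c ^ 2 + (2 + 2 * K) * δ ≤ c := by
    rcases hc.eq_or_lt with rfl | hc0
    · exact ⟨1, one_pos, fun h => absurd h (lt_irrefl _)⟩
    · refine ⟨c * (1 - c) / (2 + 2 * K), div_pos (mul_pos hc0 (by linarith)) (by positivity),
        fun _ => ?_⟩
      rw [mul_div_cancel₀ _ (by positivity)]
      linarith
  refine ⟨min (min δ₁ δ₂) (min δ₃ (1 / (1 + K))), by positivity, fun X hXM hX1 hX => ?_⟩
  simp only [lt_min_iff] at hX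
  obtain ⟨⟨hX₁, hX₂⟩, hX₃, hX₄⟩ := hX
  rw [lt_div_iff₀ (by positivity)] at hX₄
  have hinner := inner_sub_self_eq_of_norm_eq_one hA1 hX1
  have hε : ‖X - A‖ < 1 := by nlinarith [norm_nonneg (X - A)]
  have hε0 := norm_nonneg (X - A)
  refine ⟨?_, fun Y hY => ?_⟩
  · obtain ⟨Y, hY⟩ := exists_isBestRankApprox A.rank X
    refine ⟨Y, hY, fun Y' hY' => huniq X Y Y' hX₁ hY' hY.1 ?_ hY.transpose_mul_eq_zero
      hY.mul_transpose_eq_zero⟩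
    linarith [hY.2 A le_rfl]
  set e := ‖X - A‖ with he
  set Z := X - A + (e ^ 2 / 2) • A with hZdef
  have hZM : Z ∈ M := M.add_mem (M.sub_mem hXM hA) (M.smul_mem _ hA)
  have hZA : ⟪Z, A⟫ = 0 := by
    rw [hZdef, inner_add_left, inner_smul_left, hinner, real_inner_self_eq_norm_sq, hA1]
    simp
  have hZe : ‖Z‖ ≤ e := by
    have h1 : X - A = Z - (e ^ 2 / 2) • A := by rw [hZdef]; abel
    have h2 : e ^ 2 = ‖Z‖ ^ 2 + ‖(e ^ 2 / 2) • A‖ ^ 2 := by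
      conv_lhs => rw [he, h1]
      rw [norm_sub_sq_real, inner_smul_right, hZA]
      ring
    exact le_of_sq_le_sq (by nlinarith [sq_nonneg ‖(e ^ 2 / 2) • A‖]) hε0
  obtain ⟨hτ, hVA, hV⟩ := norm_tangent_le hc hPsymm hPidem hQsymm hQidem hPA hA hangle hZM hZA
  rcases hc.eq_or_lt with rfl | hc0
  · have hZPQ : Z = P * Z * Q := by
      rw [zero_mul, norm_le_zero_iff, sub_eq_zero] at hτ
      exact hτ
    have hXZ : X - (1 - e ^ 2 / 2) • A = Z := by rw [hZdef, sub_smul, one_smul]; abel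
    have hQA : Q * Aᵀ = 0 := by
      rw [← hQsymm, ← Matrix.transpose_mul, hAQ, Matrix.transpose_zero]
    have hAP : Aᵀ * P = 0 := by
      rw [← hPsymm, ← Matrix.transpose_mul, hPA, Matrix.transpose_zero]
    have hpos : 0 < 1 - e ^ 2 / 2 := by nlinarith
    obtain rfl : Y = (1 - e ^ 2 / 2) • A := by
      refine huniq X _ Y hX₁ hY ?_ ?_ ?_ ?_
      · rw [show (1 - e ^ 2 / 2) • A =
          A * ((1 - e ^ 2 / 2) • (1 : Matrix (Fin n) (Fin n) ℝ)) by simp]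
        exact Matrix.rank_mul_le_left _ _
      · rw [hXZ]; linarith
      · rw [hXZ, hZPQ, Matrix.transpose_smul, Matrix.smul_mul, Matrix.mul_assoc,
          ← Matrix.mul_assoc, hAP, Matrix.zero_mul, smul_zero]
      · rw [hXZ, hZPQ, Matrix.transpose_smul, Matrix.mul_smul, Matrix.mul_assoc, hQA,
          Matrix.mul_zero, smul_zero]
    refine ⟨_, M.smul_mem _ hA, fun Z _ => by rw [sub_self, inner_zero_left], ?_, ?_⟩
    · refine smul_ne_zero hpos.ne' ?_
      rintro rfl
      simp at hA1
    · rw [norm_smul, hA1, mul_one, Real.norm_eq_abs, abs_of_pos hpos, smul_smul,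
        inv_mul_cancel₀ hpos.ne', one_smul, sub_self, norm_zero, zero_mul]
  · set R := (X - A) - P * (X - A) * Q - (Y - A) with hRdef
    have hR : ‖R‖ ≤ K * e ^ 2 := herr X Y hX₂ hY
    have hYsplit : Y = A + (Z - P * Z * Q) - (e ^ 2 / 2) • A - R := by
      rw [hRdef, hZdef, Matrix.mul_add, Matrix.mul_smul, hPA, smul_zero, add_zero]
      abel
    obtain ⟨hW0, hW⟩ := starProjection_ne_zero_and_norm_normalize_sub_le hc hc1.le hA hA1 hVA
      (hV.trans (by gcongr)) hR hε0 hε hX₄ hYsplit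
    refine ⟨M.starProjection Y, M.starProjection_apply_mem Y,
      fun Z hZ => M.starProjection_inner_eq_zero Y Z hZ, hW0, hW.trans ?_⟩
    refine mul_le_mul_of_nonneg_right (le_trans ?_ (hδ₃c hc0)) hε0
    gcongr

theorem isBestRankApprox_iff {r : ℕ} {X Y : Matrix (Fin m) (Fin n) ℝ} :
    IsBestRankApprox r X Y ↔ Y.rank ≤ r ∧ ∀ Z : Matrix (Fin m) (Fin n) ℝ, Z.rank ≤ r →
      frobNorm (X - Y) ≤ frobNorm (X - Z) := by
  simp only [IsBestRankApprox, frobNorm_eq_norm]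

end Frobenius

/-- Local linear convergence of alternating projections (Phase II). Let `X* ∈ M`
have rank `r` and unit Frobenius norm, let `P` (resp. `Q`) be the orthogonal
projection onto the orthogonal complement of the column space of `X*` (resp. of
`X*ᵀ`), assume the nontangential intersection condition
`T_{X*}R_r ∩ M = span{X*}`, and let `θ ∈ (0, π/2]` be the angle between the
tangent spaces. Then for `X ∈ M` on the unit sphere close enough to `X*`, the best
rank-`r` approximation `T_r(X)` is unique, its orthogonal projection onto `M` is
nonzero, and the normalized iterate `X_new` satisfies
`‖X_new − X*‖_F ≤ (cos θ + C‖X − X*‖_F²)·‖X − X*‖_F`. -/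
theorem alternating_projections_local_convergence {m n r : ℕ}
    (M : Submodule ℝ (Matrix (Fin m) (Fin n) ℝ))
    (Xs : Matrix (Fin m) (Fin n) ℝ) (hXsM : Xs ∈ M)
    (hrank : Xs.rank = r) (hnorm : frobNorm Xs = 1)
    (P : Matrix (Fin m) (Fin m) ℝ) (Q : Matrix (Fin n) (Fin n) ℝ)
    (hPsymm : Pᵀ = P) (hPidem : P * P = P)
    (hPker : ∀ v : Fin m → ℝ, P.mulVec v = 0 ↔ v ∈ LinearMap.range Xs.mulVecLin)
    (hQsymm : Qᵀ = Q) (hQidem : Q * Q = Q)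
    (hQker : ∀ v : Fin n → ℝ, Q.mulVec v = 0 ↔ v ∈ LinearMap.range Xsᵀ.mulVecLin)
    (hNT : ∀ Z ∈ M, P * Z * Q = 0 → ∃ c : ℝ, Z = c • Xs)
    (θ : ℝ) (hθ0 : 0 < θ) (hθπ : θ ≤ Real.pi / 2)
    (hcos : IsGreatest {t : ℝ | ∃ Z ∈ M, ∃ Y : Matrix (Fin m) (Fin n) ℝ,
        frobInner Z Xs = 0 ∧ Z ≠ 0 ∧ P * Y * Q = 0 ∧ Y ≠ 0 ∧
        t = |frobInner Z Y| / (frobNorm Z * frobNorm Y)} (Real.cos θ)) :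
    ∃ ε₀ > 0, ∃ C > 0,
      ∀ X ∈ M, frobNorm X = 1 → frobNorm (X - Xs) < ε₀ →
        (∃! Y : Matrix (Fin m) (Fin n) ℝ, Y.rank ≤ r ∧
            ∀ Z : Matrix (Fin m) (Fin n) ℝ, Z.rank ≤ r →
              frobNorm (X - Y) ≤ frobNorm (X - Z)) ∧
        ∀ Y : Matrix (Fin m) (Fin n) ℝ,
          (Y.rank ≤ r ∧ ∀ Z : Matrix (Fin m) (Fin n) ℝ, Z.rank ≤ r →
              frobNorm (X - Y) ≤ frobNorm (X - Z)) →
          ∃ W ∈ M, (∀ Z ∈ M, frobInner (Y - W) Z = 0) ∧ W ≠ 0 ∧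
            frobNorm ((frobNorm W)⁻¹ • W - Xs) ≤
              (Real.cos θ + C * frobNorm (X - Xs) ^ 2) * frobNorm (X - Xs) := by
  obtain ⟨hPA, C, hC⟩ := mul_eq_zero_and_exists_one_sub_eq_mul hPidem hPker
  obtain ⟨hQA, D, hD⟩ := mul_eq_zero_and_exists_one_sub_eq_mul hQidem hQker
  have hAQ : Xs * Q = 0 := by
    rw [← hQsymm, ← Matrix.transpose_transpose (Xs * Qᵀ), Matrix.transpose_mul,
      Matrix.transpose_transpose, hQA, Matrix.transpose_zero]
  have hc : 0 ≤ Real.cos θ :=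
    Real.cos_nonneg_of_mem_Icc ⟨by linarith [Real.pi_pos], hθπ⟩
  have hc1 : Real.cos θ < 1 := by
    rw [← Real.cos_zero]
    exact Real.cos_lt_cos_of_nonneg_of_le_pi_div_two le_rfl hθπ hθ0
  have hangle : ∀ Z ∈ M, frobInner Z Xs = 0 → ∀ Y, P * Y * Q = 0 →
      frobInner Z Y ≤ Real.cos θ * frobNorm Z * frobNorm Y := by
    intro Z hZ hZA Y hY
    rcases eq_or_ne Z 0 with rfl | hZ0
    · simp [frobInner, frobNorm]
    rcases eq_or_ne Y 0 with rfl | hY0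
    · simp [frobInner, frobNorm]
    have h := hcos.2 ⟨Z, hZ, Y, hZA, hZ0, hY, hY0, rfl⟩
    rw [div_le_iff₀ (mul_pos (frobNorm_pos hZ0) (frobNorm_pos hY0))] at h
    linarith [le_abs_self (frobInner Z Y)]
  subst hrank
  simp only [← isBestRankApprox_iff]
  simp only [frobNorm_eq_norm] at hangle hnorm ⊢
  obtain ⟨ε, hε, h⟩ := exists_local_contraction hc hc1 hPsymm hPidem hQsymm hQidem hPA hAQ hC hD
    hXsM hnorm hangle
  refine ⟨ε, hε, 1, one_pos, fun X hXM hX1 hX => ?_⟩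
  obtain ⟨hu, hW⟩ := h X hXM hX1 hX
  refine ⟨hu, fun Y hY => ?_⟩
  obtain ⟨W, hWM, hort, hW0, hle⟩ := hW Y hY
  refine ⟨W, hWM, hort, hW0, hle.trans ?_⟩
  refine mul_le_mul_of_nonneg_right ?_ (frobNorm_eq_norm (X - Xs) ▸ Real.sqrt_nonneg _)
  rw [one_mul]
  exact le_add_of_nonneg_right (sq_nonneg _)
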